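/- arXiv:1701.07757 — 4 statements merged into one kernel-verified Lean document; each statement's English description precedes it below -/
import Mathlib

section
/- Let λ₀₀, λ₀₁, λ₁₀ ≥ 0 with λ₀₀ + λ₀₁ + λ₁₀ = 1, and let ρ = λ₀₀|00⟩⟨00| + λ₀₁|01⟩⟨01| + λ₁₀|10⟩⟨10| on ℂ² ⊗ ℂ² (so the eigenvalue of |11⟩ is 0). Then for every ε with 0 < ε ≤ 1, the state ρ_ε = (1−ε)ρ + ε|ψ₊⟩⟨ψ₊| is entangled and satisfies δ(ρ, ρ_ε) ≤ ε; hence there are entangled states arbitrarily close to ρ. -/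
open Matrix Kronecker BigOperators
open scoped ComplexOrder

noncomputable section

/-- A quantum state: positive semidefinite, trace one. -/
def IsState {n : Type*} [Fintype n] [DecidableEq n] (ρ : Matrix n n ℂ) : Prop :=
  ρ.PosSemidef ∧ ρ.trace = 1

/-- Separability on a bipartite system `ℂ^dA ⊗ ℂ^dB`. -/
def SeparableState {dA dB : ℕ} (ρ : Matrix (Fin dA × Fin dB) (Fin dA × Fin dB) ℂ) : Prop :=
  ∃ (m : ℕ) (p : Fin m → ℝ) (A : Fin m → Matrix (Fin dA) (Fin dA) ℂ)
    (B : Fin m → Matrix (Fin dB) (Fin dB) ℂ),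
    (∀ k, 0 ≤ p k) ∧ (∑ k, p k) = 1 ∧ (∀ k, IsState (A k)) ∧ (∀ k, IsState (B k)) ∧
    ρ = ∑ k, ((p k : ℂ) • (A k ⊗ₖ B k))

/-- An entangled state is a state that is not separable. -/
def EntangledState {dA dB : ℕ} (ρ : Matrix (Fin dA × Fin dB) (Fin dA × Fin dB) ℂ) : Prop :=
  IsState ρ ∧ ¬ SeparableState ρ

/-- Trace distance: half the sum of absolute values of the eigenvalues of `ρ - τ`. -/
def traceDist {n : Type*} [Fintype n] [DecidableEq n] (ρ τ : Matrix n n ℂ) : ℝ :=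
  if h : (ρ - τ).IsHermitian then (1/2) * ∑ i, |h.eigenvalues i| else 0

/-- Standard basis vector of `ℂ^d`. -/
def bv {d : ℕ} (a : ℕ) (h : a < d) : Fin d → ℂ := Pi.single ⟨a, h⟩ (1 : ℂ)

/-- Standard basis of `ℂ²`. -/
def ket2 (a : Fin 2) : Fin 2 → ℂ := Pi.single a 1

/-- Standard basis of `ℂ³`. -/
def ket3 (a : Fin 3) : Fin 3 → ℂ := Pi.single a 1

/-- `|+⟩ = (|0⟩+|1⟩)/√2`. -/
def ketPlus : Fin 2 → ℂ := (Real.sqrt 2 : ℂ)⁻¹ • (ket2 0 + ket2 1)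

/-- `|−⟩ = (|0⟩−|1⟩)/√2`. -/
def ketMinus : Fin 2 → ℂ := (Real.sqrt 2 : ℂ)⁻¹ • (ket2 0 - ket2 1)

/-- Kronecker product of vectors. -/
def vecKron {dA dB : ℕ} (v : Fin dA → ℂ) (w : Fin dB → ℂ) : Fin dA × Fin dB → ℂ :=
  fun p => v p.1 * w p.2

/-- `|ψ₊⟩ = (|01⟩+|10⟩)/√2`. -/
def psiPlus : Fin 2 × Fin 2 → ℂ :=
  (Real.sqrt 2 : ℂ)⁻¹ • (vecKron (ket2 0) (ket2 1) + vecKron (ket2 1) (ket2 0))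

/-- `|φ₊⟩ = (|00⟩+|11⟩)/√2`. -/
def phiPlus : Fin 2 × Fin 2 → ℂ :=
  (Real.sqrt 2 : ℂ)⁻¹ • (vecKron (ket2 0) (ket2 0) + vecKron (ket2 1) (ket2 1))

/-- The projector `|v⟩⟨v|`. -/
def proj {n : Type*} (v : n → ℂ) : Matrix n n ℂ := vecMulVec v (star v)

/-- Partial transpose on the first factor. -/
def PT {dA dB : ℕ} (ρ : Matrix (Fin dA × Fin dB) (Fin dA × Fin dB) ℂ) :
    Matrix (Fin dA × Fin dB) (Fin dA × Fin dB) ℂ :=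
  Matrix.of fun p q => ρ (q.1, p.2) (p.1, q.2)

/-- `⟨v|M|w⟩`. -/
def braket {n : Type*} [Fintype n] (v : n → ℂ) (M : Matrix n n ℂ) (w : n → ℂ) : ℂ :=
  star v ⬝ᵥ (M *ᵥ w)

/-- A state is classical with respect to the family of vectors `v` on the `A` side. -/
def ClassicalWrt {dA dB : ℕ} (v : Fin dA → Fin dA → ℂ)
    (ρ : Matrix (Fin dA × Fin dB) (Fin dA × Fin dB) ℂ) : Prop :=
  ∃ (lam : Fin dA → ℝ) (τ : Fin dA → Matrix (Fin dB) (Fin dB) ℂ),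
    (∀ i, 0 ≤ lam i) ∧ (∀ i, IsState (τ i)) ∧
    ρ = ∑ i, ((lam i : ℂ) • (proj (v i) ⊗ₖ τ i))

/-- Orthonormality of a family of `dA` vectors of `ℂ^dA` (hence an orthonormal basis). -/
def IsONBasis {d : ℕ} (v : Fin d → Fin d → ℂ) : Prop :=
  ∀ i j, star (v i) ⬝ᵥ v j = if i = j then 1 else 0

/-- A state is classical with respect to `A` if it is classical w.r.t. some
orthonormal basis of `ℂ^dA`; otherwise it is discordant. -/
def ClassicalA {dA dB : ℕ} (ρ : Matrix (Fin dA × Fin dB) (Fin dA × Fin dB) ℂ) : Prop :=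
  ∃ v : Fin dA → Fin dA → ℂ, IsONBasis v ∧ ClassicalWrt v ρ

/-- Hamming weight of a natural number (number of ones in binary). -/
def hammingWt (n : ℕ) : ℕ := (Nat.digits 2 n).sum

/-- A vanishing diagonal entry of a positive semidefinite `2 × 2` matrix forces the off-diagonal
entries to vanish. -/
theorem PosSemidef.offDiag_eq_zero_of_one_one {A : Matrix (Fin 2) (Fin 2) ℂ} (hA : A.PosSemidef)
    (h : A 1 1 = 0) : A 0 1 = 0 ∧ A 1 0 = 0 := by
  have hdet := hA.det_nonneg
  have hstar : A 1 0 = star (A 0 1) := (hA.isHermitian.apply 1 0).symm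
  rw [Matrix.det_fin_two, h, hstar, mul_zero, zero_sub] at hdet
  have hz : A 0 1 * star (A 0 1) = 0 :=
    le_antisymm (neg_nonneg.mp hdet) (mul_star_self_nonneg _)
  have h0 : A 0 1 = 0 := by simpa using hz
  exact ⟨h0, by rw [hstar, h0, star_zero]⟩

/-- A separable two-qubit state whose `|11⟩` diagonal entry vanishes has no coherence between
`|01⟩` and `|10⟩`. -/
theorem SeparableState.coherence_eq_zero {σ : Matrix (Fin 2 × Fin 2) (Fin 2 × Fin 2) ℂ}
    (hσ : SeparableState σ) (h : σ (1, 1) (1, 1) = 0) : σ (0, 1) (1, 0) = 0 := by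
  obtain ⟨m, p, A, B, hp, -, hA, hB, rfl⟩ := hσ
  simp only [Matrix.sum_apply, Matrix.smul_apply, Matrix.kroneckerMap_apply, smul_eq_mul] at h ⊢
  rw [Finset.sum_eq_zero_iff_of_nonneg fun k _ => mul_nonneg (by exact_mod_cast hp k)
    (mul_nonneg (hA k).1.diag_nonneg (hB k).1.diag_nonneg)] at h
  refine Finset.sum_eq_zero fun k hk => ?_
  rcases mul_eq_zero.mp (h k hk) with hpk | hAB
  · rw [hpk, zero_mul]
  rcases mul_eq_zero.mp hAB with h11 | h11
  · rw [(PosSemidef.offDiag_eq_zero_of_one_one (hA k).1 h11).1, zero_mul, mul_zero]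
  · rw [(PosSemidef.offDiag_eq_zero_of_one_one (hB k).1 h11).2, mul_zero, mul_zero]

/-- The trace distance is at most half the total trace of any decomposition of the difference
into positive semidefinite parts. -/
theorem traceDist_le_of_sub_eq {n : Type*} [Fintype n] [DecidableEq n] {ρ τ P Q : Matrix n n ℂ}
    (hP : P.PosSemidef) (hQ : Q.PosSemidef) (h : ρ - τ = P - Q) :
    traceDist ρ τ ≤ (1 / 2) * (P.trace.re + Q.trace.re) := by
  have hH : (ρ - τ).IsHermitian := h ▸ hP.isHermitian.sub hQ.isHermitian
  rw [traceDist, dif_pos hH]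
  set U : Matrix n n ℂ := ↑hH.eigenvectorUnitary
  have hUU : U * Uᴴ = 1 := Unitary.coe_mul_star_self hH.eigenvectorUnitary
  have hdiag : Uᴴ * (ρ - τ) * U = diagonal (fun i => (hH.eigenvalues i : ℂ)) := by
    have := hH.conjStarAlgAut_star_eigenvectorUnitary
    rw [Unitary.conjStarAlgAut_star_apply] at this
    exact this
  have htr (M : Matrix n n ℂ) : ∑ i, ((Uᴴ * M * U) i i).re = M.trace.re := by
    rw [← Complex.re_sum]
    change (Matrix.trace (Uᴴ * M * U)).re = _
    rw [Matrix.trace_mul_comm, ← Matrix.mul_assoc, hUU, Matrix.one_mul]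
  have hnn {M : Matrix n n ℂ} (hM : M.PosSemidef) (i : n) : 0 ≤ ((Uᴴ * M * U) i i).re :=
    (Complex.le_def.mp (hM.conjTranspose_mul_mul_same U).diag_nonneg).1
  rw [← htr P, ← htr Q, ← Finset.sum_add_distrib]
  gcongr with i
  have hi : hH.eigenvalues i = ((Uᴴ * P * U) i i).re - ((Uᴴ * Q * U) i i).re := by
    rw [← Complex.sub_re, ← Matrix.sub_apply, ← Matrix.sub_mul, ← Matrix.mul_sub, ← h, hdiag,
      Matrix.diagonal_apply_eq, Complex.ofReal_re]
  rw [hi, abs_le]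
  constructor <;> linarith [hnn hP i, hnn hQ i]

theorem posSemidef_proj {n : Type*} [Fintype n] (v : n → ℂ) : (proj v).PosSemidef :=
  Matrix.posSemidef_vecMulVec_self_star v

theorem isState_proj_psiPlus : IsState (proj psiPlus) := by
  refine ⟨posSemidef_proj _, ?_⟩
  have h2 : ((Real.sqrt 2 : ℂ))⁻¹ * (Real.sqrt 2 : ℂ)⁻¹ = 1 / 2 := by
    rw [← mul_inv, ← Complex.ofReal_mul, Real.mul_self_sqrt (by norm_num)]
    norm_num
  simp [Matrix.trace, Fintype.sum_prod_type, proj, vecMulVec_apply, psiPlus, vecKron, ket2, h2]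
  norm_num

theorem IsState.convexComb {n : Type*} [Fintype n] [DecidableEq n] {ρ τ : Matrix n n ℂ}
    (hρ : IsState ρ) (hτ : IsState τ) {ε : ℝ} (h0 : 0 ≤ ε) (h1 : ε ≤ 1) :
    IsState ((1 - (ε : ℂ)) • ρ + (ε : ℂ) • τ) := by
  have h1' : (0 : ℂ) ≤ 1 - (ε : ℂ) := by exact_mod_cast sub_nonneg.mpr h1
  have h0' : (0 : ℂ) ≤ (ε : ℂ) := by exact_mod_cast h0
  refine ⟨(hρ.1.smul h1').add (hτ.1.smul h0'), ?_⟩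
  rw [Matrix.trace_add, Matrix.trace_smul, Matrix.trace_smul, hρ.2, hτ.2]
  simp

/-- Mixing a state with weight `ε` of another one moves it by at most `ε` in trace distance. -/
theorem traceDist_convexComb_le {n : Type*} [Fintype n] [DecidableEq n] {ρ τ : Matrix n n ℂ}
    (hρ : IsState ρ) (hτ : IsState τ) {ε : ℝ} (h0 : 0 ≤ ε) :
    traceDist ρ ((1 - (ε : ℂ)) • ρ + (ε : ℂ) • τ) ≤ ε := by
  have h0' : (0 : ℂ) ≤ (ε : ℂ) := by exact_mod_cast h0
  refine (traceDist_le_of_sub_eq (hρ.1.smul h0') (hτ.1.smul h0') (by module)).trans_eq ?_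
  rw [Matrix.trace_smul, Matrix.trace_smul, hρ.2, hτ.2]
  simp
  ring


/-- for `ρ = λ₀₀|00⟩⟨00| + λ₀₁|01⟩⟨01| + λ₁₀|10⟩⟨10|` (eigenvalue of `|11⟩`
is 0), the states `ρ_ε = (1−ε)ρ + ε|ψ₊⟩⟨ψ₊|` are entangled with `δ(ρ, ρ_ε) ≤ ε`; hence
there are entangled states arbitrarily close to `ρ`. -/
theorem stmt_3 (l00 l01 l10 : ℝ) (h00 : 0 ≤ l00) (h01 : 0 ≤ l01) (h10 : 0 ≤ l10)
    (hsum : l00 + l01 + l10 = 1)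
    (ρ : Matrix (Fin 2 × Fin 2) (Fin 2 × Fin 2) ℂ)
    (hρ : ρ = (l00 : ℂ) • proj (vecKron (ket2 0) (ket2 0)) +
        (l01 : ℂ) • proj (vecKron (ket2 0) (ket2 1)) +
        (l10 : ℂ) • proj (vecKron (ket2 1) (ket2 0))) :
    (∀ ε : ℝ, 0 < ε → ε ≤ 1 →
      EntangledState ((1 - (ε : ℂ)) • ρ + (ε : ℂ) • proj psiPlus) ∧
      traceDist ρ ((1 - (ε : ℂ)) • ρ + (ε : ℂ) • proj psiPlus) ≤ ε) ∧
    (∀ ε : ℝ, 0 < ε → ∃ σ, EntangledState σ ∧ traceDist ρ σ ≤ ε) := by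
  have hstate : IsState ρ := by
    subst hρ
    refine ⟨(((posSemidef_proj _).smul (by exact_mod_cast h00)).add
      ((posSemidef_proj _).smul (by exact_mod_cast h01))).add
      ((posSemidef_proj _).smul (by exact_mod_cast h10)), ?_⟩
    have hsum' : (l00 : ℂ) + l01 + l10 = 1 := by exact_mod_cast hsum
    simpa [Matrix.trace, Fintype.sum_prod_type, proj, vecMulVec_apply, vecKron, ket2] using hsum'
  have hmain : ∀ ε : ℝ, 0 < ε → ε ≤ 1 →
      EntangledState ((1 - (ε : ℂ)) • ρ + (ε : ℂ) • proj psiPlus) ∧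
      traceDist ρ ((1 - (ε : ℂ)) • ρ + (ε : ℂ) • proj psiPlus) ≤ ε := by
    refine fun ε h0 h1 => ⟨⟨hstate.convexComb isState_proj_psiPlus h0.le h1, fun hsep => ?_⟩,
      traceDist_convexComb_le hstate isState_proj_psiPlus h0.le⟩
    have hcoh := hsep.coherence_eq_zero (by
      simp [hρ, proj, vecMulVec_apply, psiPlus, vecKron, ket2])
    simp [hρ, proj, vecMulVec_apply, psiPlus, vecKron, ket2, h0.ne'] at hcoh
  refine ⟨hmain, fun ε h0 => ⟨_, (hmain (min ε 1) (by positivity) (min_le_right _ _)).1,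
    (hmain (min ε 1) (by positivity) (min_le_right _ _)).2.trans (min_le_left _ _)⟩⟩
end
end

section
/- Let ρ = (1/2)(|00⟩⟨00| + |++⟩⟨++|) on ℂ² ⊗ ℂ², where |++⟩ = |+⟩⊗|+⟩, and let |φ₊⟩ = (|00⟩+|11⟩)/√2. Then for every ε with 0 < ε ≤ 1, the state ρ_ε = (1−ε)ρ + ε|φ₊⟩⟨φ₊| is entangled; consequently ρ is a separable state with entangled states arbitrarily close to it. -/
open Matrix Kronecker BigOperators
open scoped ComplexOrder

noncomputable section

theorem isState_proj {n : Type*} [Fintype n] [DecidableEq n] {v : n → ℂ}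
    (hv : v ⬝ᵥ star v = 1) : IsState (proj v) :=
  ⟨posSemidef_vecMulVec_self_star v, by rw [proj, trace_vecMulVec, hv]⟩

theorem IsState.convexCombination {n : Type*} [Fintype n] [DecidableEq n] {ρ τ : Matrix n n ℂ}
    (hρ : IsState ρ) (hτ : IsState τ) {t : ℝ} (h0 : 0 ≤ t) (h1 : t ≤ 1) :
    IsState ((1 - (t : ℂ)) • ρ + (t : ℂ) • τ) := by
  have ht : (0 : ℂ) ≤ (t : ℂ) := by exact_mod_cast h0
  have ht' : (0 : ℂ) ≤ 1 - (t : ℂ) := by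
    have : (0 : ℝ) ≤ 1 - t := sub_nonneg.mpr h1
    exact_mod_cast this
  refine ⟨(hρ.1.smul ht').add (hτ.1.smul ht), ?_⟩
  simp [trace_add, trace_smul, hρ.2, hτ.2]

theorem IsState.kronecker {dA dB : ℕ} {A : Matrix (Fin dA) (Fin dA) ℂ}
    {B : Matrix (Fin dB) (Fin dB) ℂ} (hA : IsState A) (hB : IsState B) : IsState (A ⊗ₖ B) :=
  ⟨hA.1.kronecker hB.1, by rw [trace_kronecker, hA.2, hB.2, mul_one]⟩

theorem proj_vecKron {dA dB : ℕ} (v : Fin dA → ℂ) (w : Fin dB → ℂ) :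
    proj (vecKron v w) = proj v ⊗ₖ proj w := by
  ext p q
  simp [proj, vecKron, vecMulVec_apply, kroneckerMap_apply]
  ring

theorem inv_sqrt_two_mul_self : ((Real.sqrt 2 : ℂ)⁻¹) * (Real.sqrt 2 : ℂ)⁻¹ = 1 / 2 := by
  rw [← mul_inv, ← Complex.ofReal_mul, Real.mul_self_sqrt (by norm_num)]
  norm_num

theorem isState_proj_ket2_zero : IsState (proj (ket2 0)) :=
  isState_proj (by simp [dotProduct, ket2])

theorem isState_proj_ketPlus : IsState (proj ketPlus) :=
  isState_proj (by
    simp [dotProduct, Fin.sum_univ_two, ketPlus, ket2, inv_sqrt_two_mul_self]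
    norm_num)

theorem isState_proj_phiPlus : IsState (proj phiPlus) :=
  isState_proj (by
    simp [dotProduct, Fintype.sum_prod_type, Fin.sum_univ_two, phiPlus, vecKron, ket2,
      inv_sqrt_two_mul_self]
    norm_num)

/-- The partial transpose of a separable two-qubit state is nonnegative on the singlet vector. -/
theorem SeparableState.singlet_partialTranspose_nonneg
    {σ : Matrix (Fin 2 × Fin 2) (Fin 2 × Fin 2) ℂ} (hσ : SeparableState σ) :
    0 ≤ σ (0, 1) (0, 1) + σ (1, 0) (1, 0) - σ (0, 0) (1, 1) - σ (1, 1) (0, 0) := by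
  obtain ⟨m, p, A, B, hp, -, hA, hB, rfl⟩ := hσ
  simp only [Matrix.sum_apply, Matrix.smul_apply, ← Finset.sum_add_distrib,
    ← Finset.sum_sub_distrib]
  refine Finset.sum_nonneg fun k _ => ?_
  have hpk : (0 : ℂ) ≤ (p k : ℂ) := by exact_mod_cast hp k
  have hv := ((hA k).1.transpose.kronecker (hB k).1).dotProduct_mulVec_nonneg
    (vecKron (ket2 0) (ket2 1) - vecKron (ket2 1) (ket2 0))
  have := mul_nonneg hpk hv
  simp [dotProduct, mulVec, Fintype.sum_prod_type, Fin.sum_univ_two, vecKron, ket2,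
    kroneckerMap_apply] at this
  simp only [smul_eq_mul, kroneckerMap_apply]
  refine this.trans_eq ?_
  ring

theorem sum_abs_eigenvalues_sub_le {n : Type*} [Fintype n] [DecidableEq n] {P Q : Matrix n n ℂ}
    (hP : P.PosSemidef) (hQ : Q.PosSemidef) (h : (P - Q).IsHermitian) :
    ∑ i, |h.eigenvalues i| ≤ (P.trace + Q.trace).re := by
  set U : Matrix n n ℂ := (h.eigenvectorUnitary : Matrix n n ℂ) with hU
  have hUU : U * Uᴴ = 1 := Unitary.coe_mul_star_self h.eigenvectorUnitary
  have htr (M : Matrix n n ℂ) : (Uᴴ * M * U).trace = M.trace := by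
    rw [trace_mul_cycle, hUU, one_mul]
  have hdiag : Uᴴ * P * U - Uᴴ * Q * U = diagonal (RCLike.ofReal ∘ h.eigenvalues) := by
    rw [← h.conjStarAlgAut_star_eigenvectorUnitary, Unitary.conjStarAlgAut_star_apply,
      ← sub_mul, ← mul_sub]
    rfl
  have hP' := hP.conjTranspose_mul_mul_same U
  have hQ' := hQ.conjTranspose_mul_mul_same U
  rw [← htr P, ← htr Q, ← trace_add, trace, Complex.re_sum]
  refine Finset.sum_le_sum fun i _ => ?_
  have hi := congrArg Complex.re (congrFun (congrFun hdiag i) i)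
  have hPi := (Complex.le_def.mp (hP'.diag_nonneg (i := i))).1
  have hQi := (Complex.le_def.mp (hQ'.diag_nonneg (i := i))).1
  simp at hi hPi hQi
  simp only [diag_apply, Matrix.add_apply, Complex.add_re]
  rw [← hi, abs_le]
  constructor <;> linarith

theorem traceDist_convexCombination_le {n : Type*} [Fintype n] [DecidableEq n]
    {ρ τ : Matrix n n ℂ} (hρ : IsState ρ) (hτ : IsState τ) {t : ℝ} (ht : 0 ≤ t) :
    traceDist ρ ((1 - (t : ℂ)) • ρ + (t : ℂ) • τ) ≤ t := by
  have htC : (0 : ℂ) ≤ (t : ℂ) := by exact_mod_cast ht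
  have hsub : ρ - ((1 - (t : ℂ)) • ρ + (t : ℂ) • τ) = (t : ℂ) • ρ - (t : ℂ) • τ := by
    module
  unfold traceDist
  rw [hsub]
  split_ifs with h
  · have := sum_abs_eigenvalues_sub_le (hρ.1.smul htC) (hτ.1.smul htC) h
    simp [trace_smul, hρ.2, hτ.2] at this
    linarith
  · exact ht

/-- for `ρ = (1/2)(|00⟩⟨00| + |++⟩⟨++|)` the states
`ρ_ε = (1−ε)ρ + ε|φ₊⟩⟨φ₊|` are entangled; consequently `ρ` is a separable state with
entangled states arbitrarily close to it. -/
theorem stmt_4 (ρ : Matrix (Fin 2 × Fin 2) (Fin 2 × Fin 2) ℂ)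
    (hρ : ρ = (1/2 : ℂ) •
      (proj (vecKron (ket2 0) (ket2 0)) + proj (vecKron ketPlus ketPlus))) :
    (∀ ε : ℝ, 0 < ε → ε ≤ 1 →
      EntangledState ((1 - (ε : ℂ)) • ρ + (ε : ℂ) • proj phiPlus)) ∧
    SeparableState ρ ∧
    (∀ ε : ℝ, 0 < ε → ∃ σ, EntangledState σ ∧ traceDist ρ σ ≤ ε) := by
  have hρ' : ρ = (1 - ((1 / 2 : ℝ) : ℂ)) • (proj (ket2 0) ⊗ₖ proj (ket2 0)) +
      ((1 / 2 : ℝ) : ℂ) • (proj ketPlus ⊗ₖ proj ketPlus) := by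
    rw [hρ, proj_vecKron, proj_vecKron, smul_add]
    norm_num
  have h0 := isState_proj_ket2_zero
  have h1 := isState_proj_ketPlus
  have hstate : IsState ρ := by
    rw [hρ']
    exact (h0.kronecker h0).convexCombination (h1.kronecker h1) (by norm_num) (by norm_num)
  have hent : ∀ ε : ℝ, 0 < ε → ε ≤ 1 →
      EntangledState ((1 - (ε : ℂ)) • ρ + (ε : ℂ) • proj phiPlus) := by
    intro ε hε hε1
    refine ⟨hstate.convexCombination isState_proj_phiPlus hε.le hε1, fun hsep => ?_⟩
    have hneg := hsep.singlet_partialTranspose_nonneg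
    have hval : ((1 - (ε : ℂ)) • ρ + (ε : ℂ) • proj phiPlus) (0, 1) (0, 1)
        + ((1 - (ε : ℂ)) • ρ + (ε : ℂ) • proj phiPlus) (1, 0) (1, 0)
        - ((1 - (ε : ℂ)) • ρ + (ε : ℂ) • proj phiPlus) (0, 0) (1, 1)
        - ((1 - (ε : ℂ)) • ρ + (ε : ℂ) • proj phiPlus) (1, 1) (0, 0) = ((-ε : ℝ) : ℂ) := by
      rw [hρ]
      simp [proj, vecMulVec_apply, vecKron, ketPlus, phiPlus, ket2, inv_sqrt_two_mul_self]
      ring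
    rw [hval] at hneg
    have : (0 : ℝ) ≤ -ε := by exact_mod_cast hneg
    linarith
  refine ⟨hent, ?_, fun ε hε => ?_⟩
  · refine ⟨2, ![1 / 2, 1 / 2], ![proj (ket2 0), proj ketPlus], ![proj (ket2 0), proj ketPlus],
      ?_, ?_, ?_, ?_, ?_⟩
    · simp [Fin.forall_fin_two]
    · norm_num [Fin.sum_univ_two]
    · simp [Fin.forall_fin_two, h0, h1]
    · simp [Fin.forall_fin_two, h0, h1]
    · have half : 1 - ((1 / 2 : ℝ) : ℂ) = ((1 / 2 : ℝ) : ℂ) := by norm_num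
      rw [hρ', half, Fin.sum_univ_two]
      rfl
  · have hpos : 0 < min ε 1 := lt_min hε one_pos
    exact ⟨_, hent _ hpos (min_le_right _ _),
      (traceDist_convexCombination_le hstate isState_proj_phiPlus hpos.le).trans (min_le_left _ _)⟩
end
end

section
/- Let dA, dB ≥ 2 and let ρ be a separable state on ℂ^{dA} ⊗ ℂ^{dB} which has a product eigenvector with eigenvalue 0: there exist unit vectors φ₀ ∈ ℂ^{dA} and ψ₀ ∈ ℂ^{dB} with ρ(φ₀ ⊗ ψ₀) = 0. Then for every ε > 0 there exists an entangled state σ with δ(ρ, σ) ≤ ε; moreover σ can be chosen so that there exist nonzero vectors e₁ ⊥ e₂ in ℂ^{dA} and f₁ ⊥ f₂ in ℂ^{dB} such that Ψ = e₁⊗f₁ + e₂⊗f₂ satisfies ⟨Ψ| PT(σ) |Ψ⟩ < 0 (so that σ is distillable by the Horodecki criterion). -/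
open Matrix Kronecker BigOperators
open scoped ComplexOrder

noncomputable section

/-- A complex space of dimension at least two has a unit vector orthogonal to a given vector. -/
theorem exists_unit_orthogonal {d : ℕ} (hd : 2 ≤ d) (φ : Fin d → ℂ) :
    ∃ v : Fin d → ℂ, star φ ⬝ᵥ v = 0 ∧ star v ⬝ᵥ v = 1 := by
  obtain ⟨w, hw, hw0⟩ : ∃ w ∈ LinearMap.ker (dotProductBilin ℂ ℂ (star φ)), w ≠ 0 := by
    apply (Submodule.ne_bot_iff _).1
    apply LinearMap.ker_ne_bot_of_finrank_lt
    simp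
    omega
  replace hw : star φ ⬝ᵥ w = 0 := hw
  have hpos : 0 < star w ⬝ᵥ w := dotProduct_star_self_pos_iff.2 hw0
  obtain ⟨hre, him⟩ := Complex.pos_iff.1 hpos
  set n := (star w ⬝ᵥ w).re with hn
  have hwn : star w ⬝ᵥ w = (n : ℂ) := Complex.ext rfl (by simpa using him.symm)
  have hs : (Real.sqrt n : ℂ) * Real.sqrt n = n := by
    exact_mod_cast Real.mul_self_sqrt hre.le
  have hs0 : (Real.sqrt n : ℂ) ≠ 0 := by
    exact_mod_cast (Real.sqrt_pos.2 hre).ne'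
  refine ⟨(Real.sqrt n : ℂ)⁻¹ • w, by simp [hw], ?_⟩
  rw [star_smul, smul_dotProduct, dotProduct_smul, hwn, ← hs]
  simp only [star_inv₀, Complex.star_def, Complex.conj_ofReal, smul_eq_mul]
  field_simp

/-- The sum of the absolute eigenvalues of a difference of positive semidefinite matrices is
at most the sum of their traces. -/
theorem sum_abs_eigenvalues_sub_le_s10 {n : Type*} [Fintype n] [DecidableEq n]
    {A B : Matrix n n ℂ} (hA : A.PosSemidef) (hB : B.PosSemidef) (h : (A - B).IsHermitian) :
    ∑ i, |h.eigenvalues i| ≤ A.trace.re + B.trace.re := by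
  set U : Matrix n n ℂ := (h.eigenvectorUnitary : Matrix n n ℂ) with hU
  have hUU : U * Uᴴ = 1 := Unitary.mul_star_self_of_mem h.eigenvectorUnitary.2
  have htr : ∀ M : Matrix n n ℂ, (Uᴴ * M * U).trace = M.trace := fun M => by
    rw [trace_mul_comm, ← Matrix.mul_assoc, hUU, Matrix.one_mul]
  have hnn : ∀ {M : Matrix n n ℂ}, M.PosSemidef → ∀ i, 0 ≤ ((Uᴴ * M * U) i i).re :=
    fun hM i => (Complex.nonneg_iff.1 (hM.conjTranspose_mul_mul_same U).diag_nonneg).1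
  have heig : ∀ i, h.eigenvalues i = ((Uᴴ * A * U) i i).re - ((Uᴴ * B * U) i i).re := by
    intro i
    have key : Uᴴ * (A - B) * U = diagonal (RCLike.ofReal ∘ h.eigenvalues) := by
      have := h.conjStarAlgAut_star_eigenvectorUnitary
      rw [Unitary.conjStarAlgAut_star_apply] at this
      exact this
    have := congrArg Complex.re (congrFun (congrFun key i) i)
    rw [Matrix.mul_sub, Matrix.sub_mul] at this
    simpa using this.symm
  calc ∑ i, |h.eigenvalues i|
      ≤ ∑ i, (((Uᴴ * A * U) i i).re + ((Uᴴ * B * U) i i).re) := by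
        refine Finset.sum_le_sum fun i _ => ?_
        have h1 := hnn hA i
        have h2 := hnn hB i
        rw [heig, abs_le]
        constructor <;> linarith
    _ = A.trace.re + B.trace.re := by
        rw [← htr A, ← htr B, Finset.sum_add_distrib]
        simp [Matrix.trace]

/-- Mixing `ρ` with weight `s` of another state moves it by at most `s` in trace distance. -/
theorem traceDist_mix_le {n : Type*} [Fintype n] [DecidableEq n]
    {ρ τ : Matrix n n ℂ} (hρ : IsState ρ) (hτ : IsState τ) {s : ℝ} (hs : 0 ≤ s) :
    traceDist ρ (((1 - s : ℝ) : ℂ) • ρ + (s : ℂ) • τ) ≤ s := by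
  have hs' : (0 : ℂ) ≤ (s : ℂ) := by exact_mod_cast hs
  have hsub : ρ - (((1 - s : ℝ) : ℂ) • ρ + (s : ℂ) • τ) = (s : ℂ) • ρ - (s : ℂ) • τ := by
    push_cast
    module
  unfold traceDist
  rw [hsub]
  split_ifs with h
  · have := sum_abs_eigenvalues_sub_le_s10 (hρ.1.smul hs') (hτ.1.smul hs') h
    simp only [trace_smul, hρ.2, hτ.2, smul_eq_mul, mul_one, Complex.ofReal_re] at this
    linarith
  · exact hs

/-- States are closed under convex combinations. -/
theorem IsState.mix {n : Type*} [Fintype n] [DecidableEq n]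
    {ρ τ : Matrix n n ℂ} (hρ : IsState ρ) (hτ : IsState τ) {s : ℝ} (hs : 0 ≤ s) (hs1 : s ≤ 1) :
    IsState (((1 - s : ℝ) : ℂ) • ρ + (s : ℂ) • τ) := by
  refine ⟨(hρ.1.smul ?_).add (hτ.1.smul ?_), ?_⟩
  · exact_mod_cast sub_nonneg.2 hs1
  · exact_mod_cast hs
  · simp [hρ.2, hτ.2]

/-- Peres criterion: separable states have positive semidefinite partial transpose. -/
theorem SeparableState.posSemidef_PT {dA dB : ℕ}
    {ρ : Matrix (Fin dA × Fin dB) (Fin dA × Fin dB) ℂ} (h : SeparableState ρ) :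
    (PT ρ).PosSemidef := by
  obtain ⟨m, p, A, B, hp, -, hA, hB, rfl⟩ := h
  have : PT (∑ k, ((p k : ℂ) • (A k ⊗ₖ B k))) = ∑ k, ((p k : ℂ) • ((A k)ᵀ ⊗ₖ B k)) := by
    ext x y
    simp [PT, Matrix.sum_apply]
  rw [this]
  refine posSemidef_sum _ fun k _ => ((hA k).1.transpose.kronecker (hB k).1).smul ?_
  exact_mod_cast hp k

theorem braket_PT_vecKron {dA dB : ℕ} (M : Matrix (Fin dA × Fin dB) (Fin dA × Fin dB) ℂ)
    (a c : Fin dA → ℂ) (b d : Fin dB → ℂ) :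
    braket (vecKron (star a) b) (PT M) (vecKron (star c) d) =
      braket (vecKron c b) M (vecKron a d) := by
  simp only [braket, dotProduct, mulVec, Fintype.sum_prod_type, vecKron, PT, Matrix.of_apply,
    Pi.star_apply, star_mul', star_star, Finset.mul_sum]
  have swap : ∀ F : Fin dA → Fin dB → Fin dA → Fin dB → ℂ,
      ∑ x, ∑ y, ∑ z, ∑ w, F x y z w = ∑ z, ∑ y, ∑ x, ∑ w, F x y z w := by
    intro F
    rw [Finset.sum_comm]
    rw [Finset.sum_congr rfl fun y _ => Finset.sum_comm]
    rw [Finset.sum_comm]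
  rw [swap]
  refine Finset.sum_congr rfl fun _ _ => Finset.sum_congr rfl fun _ _ =>
    Finset.sum_congr rfl fun _ _ => Finset.sum_congr rfl fun _ _ => ?_
  ring

theorem star_vecKron_dotProduct {dA dB : ℕ} (a c : Fin dA → ℂ) (b d : Fin dB → ℂ) :
    star (vecKron a b) ⬝ᵥ vecKron c d = (star a ⬝ᵥ c) * (star b ⬝ᵥ d) := by
  simp only [dotProduct, Fintype.sum_prod_type, vecKron, Pi.star_apply, star_mul',
    Finset.sum_mul_sum]
  refine Finset.sum_congr rfl fun _ _ => Finset.sum_congr rfl fun _ _ => ?_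
  ring

theorem braket_proj {n : Type*} [Fintype n] (v u w : n → ℂ) :
    braket v (proj u) w = (star v ⬝ᵥ u) * (star u ⬝ᵥ w) := by
  simp [braket, proj, vecMulVec_mulVec, mul_comm]

theorem vecKron_smul_left {dA dB : ℕ} (z : ℂ) (a : Fin dA → ℂ) (b : Fin dB → ℂ) :
    vecKron (z • a) b = z • vecKron a b := by
  ext x
  simp [vecKron, mul_assoc]

theorem braket_add_smul {n : Type*} [Fintype n] (v w : n → ℂ) (M : Matrix n n ℂ) (t : ℝ) :
    braket (v + (t : ℂ) • w) M (v + (t : ℂ) • w) =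
      braket v M v + t * (braket v M w + braket w M v) + t ^ 2 * braket w M w := by
  simp only [braket, star_add, star_smul, mulVec_add, mulVec_smul, add_dotProduct,
    dotProduct_add, smul_dotProduct, dotProduct_smul, smul_eq_mul, Complex.star_def,
    Complex.conj_ofReal]
  ring

theorem braket_mix {n : Type*} [Fintype n] (v w : n → ℂ) (M N : Matrix n n ℂ) (x y : ℂ) :
    braket v (x • M + y • N) w = x * braket v M w + y * braket v N w := by
  simp [braket, add_mulVec, smul_mulVec, dotProduct_add]

theorem PT_mix {dA dB : ℕ} (M N : Matrix (Fin dA × Fin dB) (Fin dA × Fin dB) ℂ) (x y : ℂ) :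
    PT (x • M + y • N) = x • PT M + y • PT N := by
  ext
  simp [PT]

theorem isState_half_proj {n : Type*} [Fintype n] [DecidableEq n] {u : n → ℂ}
    (hu : star u ⬝ᵥ u = 2) : IsState ((1 / 2 : ℂ) • proj u) := by
  refine ⟨(posSemidef_vecMulVec_self_star u).smul (by positivity), ?_⟩
  rw [trace_smul, proj, trace_vecMulVec, dotProduct_comm, hu]
  norm_num

/-- a separable state with a product eigenvector of eigenvalue 0 has
entangled states arbitrarily close to it, and those can be chosen to violate positivity
of the partial transpose on a vector `e₁⊗f₁ + e₂⊗f₂` (hence to be distillable by the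
Horodecki criterion). -/
theorem stmt_10 (dA dB : ℕ) (hA : 2 ≤ dA) (hB : 2 ≤ dB)
    (ρ : Matrix (Fin dA × Fin dB) (Fin dA × Fin dB) ℂ)
    (hρ : IsState ρ) (hsep : SeparableState ρ)
    (φ0 : Fin dA → ℂ) (ψ0 : Fin dB → ℂ)
    (hφ0 : star φ0 ⬝ᵥ φ0 = 1) (hψ0 : star ψ0 ⬝ᵥ ψ0 = 1)
    (hker : ρ *ᵥ vecKron φ0 ψ0 = 0) :
    ∀ ε : ℝ, 0 < ε → ∃ σ, EntangledState σ ∧ traceDist ρ σ ≤ ε ∧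
      ∃ (e1 e2 : Fin dA → ℂ) (f1 f2 : Fin dB → ℂ),
        e1 ≠ 0 ∧ e2 ≠ 0 ∧ f1 ≠ 0 ∧ f2 ≠ 0 ∧
        star e1 ⬝ᵥ e2 = 0 ∧ star f1 ⬝ᵥ f2 = 0 ∧
        ∃ r : ℝ, r < 0 ∧
          braket (vecKron e1 f1 + vecKron e2 f2) (PT σ)
            (vecKron e1 f1 + vecKron e2 f2) = (r : ℂ) := by
  intro ε hε
  obtain ⟨φ1, hφ01, hφ1⟩ := exists_unit_orthogonal hA φ0
  obtain ⟨ψ1, hψ01, hψ1⟩ := exists_unit_orthogonal hB ψ0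
  have hφ10 : star φ1 ⬝ᵥ φ0 = 0 := by
    rw [star_dotProduct, hφ01, star_zero]
  have hψ10 : star ψ1 ⬝ᵥ ψ0 = 0 := by
    rw [star_dotProduct, hψ01, star_zero]
  set Φ := vecKron φ0 ψ1 + vecKron φ1 ψ0 with hΦ
  have hτ : IsState ((1 / 2 : ℂ) • proj Φ) := by
    apply isState_half_proj
    simp only [hΦ, star_add, add_dotProduct, dotProduct_add, star_vecKron_dotProduct,
      hφ0, hφ1, hψ0, hψ1, hφ01, hφ10]
    norm_num
  set τ := (1 / 2 : ℂ) • proj Φ with hτdef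
  have hτb : ∀ a c b d, braket (vecKron a b) τ (vecKron c d) =
      1 / 2 * ((star (vecKron a b) ⬝ᵥ Φ) * (star Φ ⬝ᵥ vecKron c d)) := by
    intro a c b d
    rw [← braket_proj, hτdef, braket, smul_mulVec, dotProduct_smul, smul_eq_mul, braket]
  set v := vecKron (star φ0) ψ0 with hv
  set w := vecKron (star φ1) ψ1 with hw
  have hPT := hsep.posSemidef_PT
  have hvv : braket v (PT ρ) v = 0 := by
    rw [braket_PT_vecKron, braket, hker, dotProduct_zero]
  have hkerv : PT ρ *ᵥ v = 0 := (hPT.dotProduct_mulVec_zero_iff v).1 hvv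
  have hwv : braket w (PT ρ) v = 0 := by rw [braket, hkerv, dotProduct_zero]
  have hvw : braket v (PT ρ) w = 0 := by
    rw [braket, dotProduct_mulVec, ← hPT.1.eq, ← star_mulVec, hkerv, star_zero, zero_dotProduct]
  obtain ⟨hc, hcim⟩ := Complex.nonneg_iff.1 (hPT.dotProduct_mulVec_nonneg w)
  set c := (star w ⬝ᵥ (PT ρ *ᵥ w)).re with hcdef
  have hww : braket w (PT ρ) w = (c : ℂ) := Complex.ext rfl (by simpa [braket] using hcim.symm)
  have hτvv : braket v (PT τ) v = 0 := by
    simp [hv, braket_PT_vecKron, hτb, hΦ, star_vecKron_dotProduct, hφ01, hψ01]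
  have hτww : braket w (PT τ) w = 0 := by
    simp [hw, braket_PT_vecKron, hτb, hΦ, star_vecKron_dotProduct, hφ10, hψ10]
  have hτvw : braket v (PT τ) w = 1 / 2 := by
    simp [hv, hw, braket_PT_vecKron, hτb, hΦ, star_vecKron_dotProduct, hφ0, hφ1, hψ0, hψ1,
      hφ10]
  have hτwv : braket w (PT τ) v = 1 / 2 := by
    simp [hv, hw, braket_PT_vecKron, hτb, hΦ, star_vecKron_dotProduct, hφ0, hφ1, hψ0, hψ1,
      hφ01]
  set s : ℝ := min ε 1 with hs
  have hs0 : 0 < s := lt_min hε one_pos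
  have hs1 : s ≤ 1 := min_le_right _ _
  set σ := ((1 - s : ℝ) : ℂ) • ρ + (s : ℂ) • τ with hσ
  set t : ℝ := s / (c + 1) with ht
  have ht0 : 0 < t := by positivity
  have hneg : (1 - s) * (t ^ 2 * c) - s * t < 0 := by
    have h1 : t * (c + 1) = s := by rw [ht]; field_simp
    have h2 : t * c < s := by linarith
    have h3 : t ^ 2 * c < s * t := by nlinarith
    have h4 : 0 ≤ s * (t ^ 2 * c) := by positivity
    linarith
  have hval : braket (v + ((-t : ℝ) : ℂ) • w) (PT σ) (v + ((-t : ℝ) : ℂ) • w) =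
      (((1 - s) * (t ^ 2 * c) - s * t : ℝ) : ℂ) := by
    rw [hσ, PT_mix, braket_mix, braket_add_smul, braket_add_smul, hvv, hvw, hwv, hww,
      hτvv, hτww, hτvw, hτwv]
    push_cast
    ring
  have hne : ∀ {d : ℕ} {x : Fin d → ℂ}, star x ⬝ᵥ x = 1 → x ≠ 0 := by
    rintro d x hx rfl
    simp at hx
  refine ⟨σ, ⟨hρ.mix hτ hs0.le hs1, fun hsepσ => ?_⟩,
    (traceDist_mix_le hρ hτ hs0.le).trans (min_le_left _ _),
    star φ0, ((-t : ℝ) : ℂ) • star φ1, ψ0, ψ1, star_ne_zero.2 (hne hφ0),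
    smul_ne_zero (by exact_mod_cast (neg_lt_zero.2 ht0).ne) (star_ne_zero.2 (hne hφ1)),
    hne hψ0, hne hψ1, ?_, hψ01, _, hneg, ?_⟩
  · have h0 := hsepσ.posSemidef_PT.dotProduct_mulVec_nonneg (v + ((-t : ℝ) : ℂ) • w)
    change 0 ≤ braket _ _ _ at h0
    rw [hval] at h0
    have : 0 ≤ (1 - s) * (t ^ 2 * c) - s * t := by exact_mod_cast h0
    linarith
  · rw [star_star, dotProduct_smul, dotProduct_comm, hφ10, smul_zero]
  · rw [vecKron_smul_left]
    exact hval
end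
end

section
/- Let dA, dB ≥ 2 and write |ab⟩ = e_a ⊗ e_b for Kronecker products of standard basis vectors. Let ρ = Σ_{i,j} μ_{ij} (e_i e_i*) ⊗ (U_i e_j e_j* U_i†) be a state on ℂ^{dA} ⊗ ℂ^{dB}, where each U_i is unitary on ℂ^{dB}, U_0 = I, μ_{ij} ≥ 0, Σ_{i,j} μ_{ij} = 1, and μ_{00} ≤ μ_{ij} for all i,j. Let ρ₁ be any state with ⟨00|ρ₁|00⟩ = 0 and ⟨10|ρ₁|01⟩ ≠ 0. Then for every ε with 0 < ε ≤ 1, the state ρ_ε = (1−ε)ρ + ερ₁ is discordant (not classical with respect to A). -/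
open Matrix Kronecker BigOperators
open scoped ComplexOrder

noncomputable section

theorem sum_proj_eq_one {d : ℕ} {v : Fin d → Fin d → ℂ} (hv : IsONBasis v) :
    ∑ i, proj (v i) = 1 := by
  have h : (Matrix.of v).map star * (Matrix.of v)ᵀ = 1 := by
    ext i j
    simpa [Matrix.mul_apply, dotProduct, Matrix.one_apply] using hv i j
  have h' : (Matrix.of v)ᵀ * (Matrix.of v).map star = 1 := mul_eq_one_comm.mp h
  ext a b
  have h' := congrFun (congrFun h' a) b
  simpa [Matrix.mul_apply, Matrix.sum_apply, proj, vecMulVec_apply] using h'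

theorem isONBasis_single (d : ℕ) : IsONBasis (fun i : Fin d => (Pi.single i 1 : Fin d → ℂ)) := by
  intro i j
  simp [dotProduct, Pi.single_apply, eq_comm]

theorem proj_posSemidef {n : Type*} [Finite n] (v : n → ℂ) : (proj v).PosSemidef :=
  posSemidef_vecMulVec_self_star v

/-- The conditional operators of a positive semidefinite block-diagonal operator are
positive semidefinite. -/
theorem posSemidef_of_sum_proj_kronecker {d : ℕ} {m : Type*} [Fintype m] [DecidableEq m]
    {v : Fin d → Fin d → ℂ} (hv : IsONBasis v) {S : Fin d → Matrix m m ℂ}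
    (hX : (∑ i, proj (v i) ⊗ₖ S i).PosSemidef) (i : Fin d) : (S i).PosSemidef := by
  let W : Matrix (Fin d × m) (Unit × m) ℂ := replicateCol Unit (v i) ⊗ₖ (1 : Matrix m m ℂ)
  have hW := (hX.conjTranspose_mul_mul_same W).submatrix (fun b : m => ((), b))
  have hterm : ∀ j, Wᴴ * (proj (v j) ⊗ₖ S j) * W
      = (if i = j then 1 else 0 : Matrix Unit Unit ℂ) ⊗ₖ S j := by
    intro j
    have hcol : (replicateCol Unit (v i))ᴴ * proj (v j) * replicateCol Unit (v i)
        = (if i = j then 1 else 0 : Matrix Unit Unit ℂ) := by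
      have h1 : (replicateCol Unit (v i))ᴴ * replicateCol Unit (v j)
          = (if i = j then 1 else 0 : Matrix Unit Unit ℂ) := by
        ext x y
        have := hv i j
        simp only [dotProduct] at this
        split_ifs at this ⊢ with hij <;> simpa [Matrix.mul_apply] using this
      have h2 : (replicateCol Unit (v j))ᴴ * replicateCol Unit (v i)
          = (if i = j then 1 else 0 : Matrix Unit Unit ℂ) := by
        have := congrArg conjTranspose h1
        split_ifs at this ⊢ <;> simpa using this
      have h3 : proj (v j) = replicateCol Unit (v j) * (replicateCol Unit (v j))ᴴ := by
        ext x y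
        simp [proj, vecMulVec_apply, Matrix.mul_apply]
      rw [h3, ← Matrix.mul_assoc, h1, Matrix.mul_assoc, h2]
      split_ifs <;> simp
    simp only [W, conjTranspose_kronecker, ← mul_kronecker_mul, hcol, conjTranspose_one,
      Matrix.one_mul, Matrix.mul_one]
  have hS : (Wᴴ * (∑ j, proj (v j) ⊗ₖ S j) * W).submatrix (fun b : m => ((), b))
      (fun b : m => ((), b)) = S i := by
    rw [Matrix.mul_sum, Matrix.sum_mul, Finset.sum_congr rfl fun j _ => hterm j,
      Finset.sum_eq_single i (by intro j _ hj; simp [hj.symm]) (by simp)]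
    ext b b'
    simp
  rwa [hS] at hW

/-- A zero diagonal entry of a positive semidefinite matrix forces its row to vanish. -/
theorem Matrix.PosSemidef.apply_eq_zero_of_diag {n : Type*} [Fintype n] [DecidableEq n]
    {M : Matrix n n ℂ} (hM : M.PosSemidef) {a : n} (h : M a a = 0) (b : n) : M a b = 0 := by
  have h0 : M *ᵥ Pi.single a 1 = 0 := by
    rw [← hM.dotProduct_mulVec_zero_iff]
    simpa [← Pi.single_star] using h
  have hb : M b a = 0 := by simpa using congrFun h0 b
  rw [← hM.isHermitian.apply, hb, star_zero]

/-- In a positive semidefinite operator that is block-diagonal for an orthonormal basis of the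
first factor, a zero diagonal entry at `(a, b)` forces the entries at `(a', b), (a, b')` to
vanish. -/
theorem apply_eq_zero_of_sum_proj_kronecker {d : ℕ} {m : Type*} [Fintype m] [DecidableEq m]
    {v : Fin d → Fin d → ℂ} (hv : IsONBasis v) {S : Fin d → Matrix m m ℂ}
    (hX : (∑ i, proj (v i) ⊗ₖ S i).PosSemidef) {a : Fin d} {b : m}
    (h : (∑ i, proj (v i) ⊗ₖ S i) (a, b) (a, b) = 0) (a' : Fin d) (b' : m) :
    (∑ i, proj (v i) ⊗ₖ S i) (a', b) (a, b') = 0 := by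
  have hS := posSemidef_of_sum_proj_kronecker hv hX
  rw [Matrix.sum_apply] at h ⊢
  rw [Finset.sum_eq_zero_iff_of_nonneg
    fun i _ => ((proj_posSemidef (v i)).kronecker (hS i)).diag_nonneg] at h
  refine Finset.sum_eq_zero fun i hi => ?_
  have hi' := h i hi
  simp only [kronecker_apply, proj, vecMulVec_apply, Pi.star_apply, mul_eq_zero,
    star_eq_zero, or_self] at hi' ⊢
  rcases hi' with h0 | h0
  · exact Or.inl (Or.inr h0)
  · exact Or.inr ((hS i).apply_eq_zero_of_diag h0 b')

theorem sum_proj_kronecker_conj_eq_one {dA dB : ℕ} {U : Fin dA → Matrix (Fin dB) (Fin dB) ℂ}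
    (hU : ∀ i, U i * (U i)ᴴ = 1) :
    ∑ i, ∑ j, proj (Pi.single i 1 : Fin dA → ℂ) ⊗ₖ
      (U i * proj (Pi.single j 1 : Fin dB → ℂ) * (U i)ᴴ) = 1 := by
  have hB : ∑ j, proj (Pi.single j 1 : Fin dB → ℂ) = 1 := sum_proj_eq_one (isONBasis_single dB)
  have hA : ∑ i, proj (Pi.single i 1 : Fin dA → ℂ) = 1 := sum_proj_eq_one (isONBasis_single dA)
  have hinner : ∀ i, ∑ j, proj (Pi.single i 1 : Fin dA → ℂ) ⊗ₖ
      (U i * proj (Pi.single j 1 : Fin dB → ℂ) * (U i)ᴴ)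
      = proj (Pi.single i 1 : Fin dA → ℂ) ⊗ₖ (1 : Matrix (Fin dB) (Fin dB) ℂ) := by
    intro i
    have h : ∑ j, U i * proj (Pi.single j 1 : Fin dB → ℂ) * (U i)ᴴ = 1 := by
      rw [← Matrix.sum_mul, ← Matrix.mul_sum, hB, Matrix.mul_one, hU i]
    rw [← h]
    ext ⟨a, b⟩ ⟨a', b'⟩
    simp only [Matrix.sum_apply, kronecker_apply, Finset.mul_sum]
  rw [Finset.sum_congr rfl fun i _ => hinner i, ← one_kronecker_one, ← hA]
  ext ⟨a, b⟩ ⟨a', b'⟩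
  simp only [Matrix.sum_apply, kronecker_apply, Finset.sum_mul]

theorem braket_vecKron_single {dA dB : ℕ} (M : Matrix (Fin dA × Fin dB) (Fin dA × Fin dB) ℂ)
    (a a' : Fin dA) (b b' : Fin dB) :
    braket (vecKron (Pi.single a 1) (Pi.single b 1)) M
      (vecKron (Pi.single a' 1) (Pi.single b' 1)) = M (a, b) (a', b') := by
  have h : ∀ (a : Fin dA) (b : Fin dB), vecKron (Pi.single a 1) (Pi.single b 1)
      = Pi.single (a, b) (1 : ℂ) := by
    intro a b
    ext p
    simp [vecKron, Pi.single_apply, Prod.ext_iff, ite_and]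
    split_ifs <;> rfl
  rw [h, h, braket]
  simp

/-- for a classical-with-respect-to-`A` state
`ρ = Σ_{ij} μ_{ij} |i⟩⟨i| ⊗ U_i|j⟩⟨j|U_i†` with `U_0 = I` and minimal eigenvalue
`μ₀₀`, and any state `ρ₁` with `⟨00|ρ₁|00⟩ = 0` and `⟨10|ρ₁|01⟩ ≠ 0`, the state
`ρ_ε = (1−ε)ρ + ερ₁` is discordant for all `0 < ε ≤ 1`. -/
theorem stmt_15 (dA dB : ℕ) (hA : 2 ≤ dA) (hB : 2 ≤ dB)
    (μ : Fin dA → Fin dB → ℝ) (hμ0 : ∀ i j, 0 ≤ μ i j)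
    (hμ1 : ∑ i, ∑ j, μ i j = 1)
    (U : Fin dA → Matrix (Fin dB) (Fin dB) ℂ)
    (hU : ∀ i, U i * (U i)ᴴ = 1 ∧ (U i)ᴴ * U i = 1)
    (hU0 : U ⟨0, by omega⟩ = 1)
    (hμmin : ∀ i j, μ ⟨0, by omega⟩ ⟨0, by omega⟩ ≤ μ i j)
    (ρ : Matrix (Fin dA × Fin dB) (Fin dA × Fin dB) ℂ)
    (hρ : ρ = ∑ i, ∑ j, ((μ i j : ℂ) •
        (proj (Pi.single i 1 : Fin dA → ℂ) ⊗ₖ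
          (U i * proj (Pi.single j 1 : Fin dB → ℂ) * (U i)ᴴ))))
    (ρ1 : Matrix (Fin dA × Fin dB) (Fin dA × Fin dB) ℂ) (hρ1 : IsState ρ1)
    (h00ρ1 : braket (vecKron (bv (d := dA) 0 (by omega)) (bv (d := dB) 0 (by omega))) ρ1
        (vecKron (bv (d := dA) 0 (by omega)) (bv (d := dB) 0 (by omega))) = 0)
    (h10ρ1 : braket (vecKron (bv (d := dA) 1 (by omega)) (bv (d := dB) 0 (by omega))) ρ1
        (vecKron (bv (d := dA) 0 (by omega)) (bv (d := dB) 1 (by omega))) ≠ 0) :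
    ∀ ε : ℝ, 0 < ε → ε ≤ 1 →
      ¬ ClassicalA ((1 - (ε : ℂ)) • ρ + (ε : ℂ) • ρ1) := by
  rintro ε hε hε1 ⟨v, hv, lam, τ, -, -, hτ⟩
  rw [bv, bv, braket_vecKron_single] at h00ρ1
  rw [bv, bv, bv, bv, braket_vecKron_single] at h10ρ1
  set a0 : Fin dA := ⟨0, by omega⟩
  set a1 : Fin dA := ⟨1, by omega⟩
  set b0 : Fin dB := ⟨0, by omega⟩
  set b1 : Fin dB := ⟨1, by omega⟩
  have ha : a1 ≠ a0 := by simp [a0, a1]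
  set m : ℝ := μ a0 b0
  have hshift : ρ - (m : ℂ) • 1 = ∑ i, ∑ j, (((μ i j - m : ℝ) : ℂ) •
      (proj (Pi.single i 1 : Fin dA → ℂ) ⊗ₖ
        (U i * proj (Pi.single j 1 : Fin dB → ℂ) * (U i)ᴴ))) := by
    rw [hρ, ← sum_proj_kronecker_conj_eq_one fun i => (hU i).1]
    simp only [Finset.smul_sum, ← Finset.sum_sub_distrib, ← sub_smul, Complex.ofReal_sub]
  have hpsd : (ρ - (m : ℂ) • 1).PosSemidef := by
    rw [hshift]
    refine posSemidef_sum _ fun i _ => posSemidef_sum _ fun j _ => PosSemidef.smul ?_ ?_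
    · exact (proj_posSemidef _).kronecker ((proj_posSemidef _).mul_mul_conjTranspose_same _)
    · exact Complex.zero_le_real.mpr (sub_nonneg.mpr (hμmin i j))
  have hρ00 : ρ (a0, b0) (a0, b0) = m := by
    rw [hρ]
    simp only [Matrix.sum_apply, Matrix.smul_apply, kronecker_apply]
    rw [Finset.sum_eq_single a0 (by intro i _ hi; simp [proj, vecMulVec_apply, hi.symm]) (by simp),
      Finset.sum_eq_single b0
        (by intro j _ hj; simp [hU0, proj, vecMulVec_apply, hj.symm]) (by simp)]
    simp [hU0, proj, vecMulVec_apply, m]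
  have hρ10 : ρ (a1, b0) (a0, b1) = 0 := by
    rw [hρ]
    simp only [Matrix.sum_apply, Matrix.smul_apply, kronecker_apply]
    refine Finset.sum_eq_zero fun i _ => Finset.sum_eq_zero fun j _ => ?_
    by_cases hi : a1 = i
    · subst hi
      simp [proj, vecMulVec_apply, ha.symm]
    · simp [proj, vecMulVec_apply, Pi.single_apply, hi]
  let X := (1 - (ε : ℂ)) • (ρ - (m : ℂ) • 1) + (ε : ℂ) • ρ1
  have hX : X = ∑ i, proj (v i) ⊗ₖ ((lam i : ℂ) • τ i - ((1 - (ε : ℂ)) * m) • 1) := by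
    have h1 : (1 : Matrix (Fin dA × Fin dB) (Fin dA × Fin dB) ℂ)
        = ∑ i, proj (v i) ⊗ₖ (1 : Matrix (Fin dB) (Fin dB) ℂ) := by
      rw [← one_kronecker_one, ← sum_proj_eq_one hv]
      ext ⟨a, b⟩ ⟨a', b'⟩
      simp only [Matrix.sum_apply, kronecker_apply, Finset.sum_mul]
    have h2 : X = ((1 - (ε : ℂ)) • ρ + (ε : ℂ) • ρ1) - ((1 - (ε : ℂ)) * m) • 1 := by
      simp only [X, smul_sub, smul_smul]
      abel
    rw [h2, hτ, h1, Finset.smul_sum, ← Finset.sum_sub_distrib]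
    refine Finset.sum_congr rfl fun i _ => ?_
    ext ⟨a, b⟩ ⟨a', b'⟩
    simp only [Matrix.sub_apply, Matrix.smul_apply, kronecker_apply, smul_eq_mul]
    ring
  have hXpsd : X.PosSemidef := by
    refine (hpsd.smul ?_).add (hρ1.1.smul (Complex.zero_le_real.mpr hε.le))
    exact_mod_cast Complex.zero_le_real.mpr (sub_nonneg.mpr hε1)
  have hX00 : X (a0, b0) (a0, b0) = 0 := by
    simp [X, hρ00, h00ρ1]
  have hX10 : X (a1, b0) (a0, b1) = (ε : ℂ) * ρ1 (a1, b0) (a0, b1) := by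
    simp [X, hρ10, ha]
  have hzero : X (a1, b0) (a0, b1) = 0 := by
    rw [hX] at hXpsd hX00 ⊢
    exact apply_eq_zero_of_sum_proj_kronecker hv hXpsd hX00 a1 b1
  rw [hX10] at hzero
  exact mul_ne_zero (Complex.ofReal_ne_zero.mpr hε.ne') h10ρ1 hzero
end
end
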